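/- arXiv:math/0606159 — 2 statements merged into one kernel-verified Lean document; each statement's English description precedes it below -/
import Mathlib

section
/- Let G = G_1 * G_2 * ... * G_n * F and H = H_1 * H_2 * ... * H_m * F' be free products, where each factor G_i is not infinite cyclic, each factor H_j is nontrivial, and F, F' are free groups of finite rank. Let φ: G → H be a surjective group homomorphism such that each factor G_i is mapped by φ into a conjugate of some H_j. Then n + rank(F) ≥ m + rank(F') and rank(F) ≥ rank(F'). -/
universe u

open Monoid

instance sumElimGroup {α β : Type*} (A : α → Type u) (B : β → Type u)
    [∀ a, Group (A a)] [∀ b, Group (B b)] (x : α ⊕ β) : Group (Sum.elim A B x) :=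
  match x with
  | .inl a => inferInstanceAs (Group (A a))
  | .inr b => inferInstanceAs (Group (B b))

/-- The free factor `G_i` of a free product, viewed as a subgroup. -/
def factorSubgroup {ι : Type*} {M : ι → Type*} [∀ i, Group (M i)] (i : ι) :
    Subgroup (CoprodI M) := (CoprodI.of (i := i)).range

/-- The conjugate `g S g⁻¹` of a subgroup `S`. -/
def conjSubgroup {G : Type*} [Group G] (g : G) (S : Subgroup G) : Subgroup G :=
  S.map (MulAut.conj g).toMonoidHom

/-- The `n`-th iterate of an endomorphism. -/
def iterHom {G : Type*} [Group G] (φ : G →* G) : ℕ → (G →* G)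
  | 0 => MonoidHom.id G
  | n + 1 => φ.comp (iterHom φ n)

/-- The stable image `φ^∞(G) = ⋂ₙ φⁿ(G)`. -/
def stableImage {G : Type*} [Group G] (φ : G →* G) : Subgroup G :=
  ⨅ n : ℕ, (iterHom φ (n + 1)).range

/-- The fixed subgroup of an endomorphism. -/
def fixedSubgroup {G : Type*} [Group G] (φ : G →* G) : Subgroup G where
  carrier := {g | φ g = g}
  one_mem' := by simp
  mul_mem' := by intro a b ha hb; simp only [Set.mem_setOf_eq, map_mul] at *; rw [ha, hb]
  inv_mem' := by intro a ha; simp only [Set.mem_setOf_eq, map_inv] at *; rw [ha]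

/-- `H` has Kurosh rank at most `k` with respect to the given splitting. -/
def HasKuroshRankLE {ι : Type} {M : ι → Type} [∀ i, Group (M i)]
    (H : Subgroup (CoprodI M)) (k : ℕ) : Prop :=
  ∃ (m r : ℕ) (J : Fin m → ι) (g : Fin m → CoprodI M)
    (e : H ≃* CoprodI (Sum.elim
      (fun i : Fin m => ↥(conjSubgroup (g i) (factorSubgroup (J i)) ⊓ H))
      (fun _ : Fin r => Multiplicative ℤ))),
    m + r ≤ k ∧
    (∀ i : Fin m, Nontrivial ↥(conjSubgroup (g i) (factorSubgroup (J i)) ⊓ H)) ∧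
    ∀ (i : Fin m) (x : ↥(conjSubgroup (g i) (factorSubgroup (J i)) ⊓ H)),
      ((e.symm (CoprodI.of (i := Sum.inl i) x) : H) : CoprodI M) = (x : CoprodI M)

section EquivariantTrace

open Filter Topology ContinuousLinearMap
open scoped InnerProductSpace

variable {K : Type*} [Group K] {ι κ : Type*} [Fintype ι] [Fintype κ]
  {E F : Type*} [NormedAddCommGroup E] [InnerProductSpace ℝ E]
  [NormedAddCommGroup F] [InnerProductSpace ℝ F]

/-- The translates `ρ g (ξ i)` form a Parseval frame. -/
def IsParsevalFrame (ρ : K → E →L[ℝ] E) (ξ : ι → E) : Prop :=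
  ∀ x y : E, HasSum (fun g => ∑ i, ⟪x, ρ g (ξ i)⟫_ℝ * ⟪ρ g (ξ i), y⟫_ℝ) ⟪x, y⟫_ℝ

/-- The operators `ρ g` behave like a unitary action under taking adjoints. -/
def IsUnitaryFamily (ρ : K → E →L[ℝ] E) : Prop :=
  ∀ (g : K) (x y : E), ⟪ρ g x, y⟫_ℝ = ⟪x, ρ g⁻¹ y⟫_ℝ

lemma IsParsevalFrame.sum_inner_comp_comm [CompleteSpace E] [CompleteSpace F]
    {ρ : K → E →L[ℝ] E} {σ : K → F →L[ℝ] F} {ξ : ι → E} {η : κ → F}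
    (hξ : IsParsevalFrame ρ ξ) (hη : IsParsevalFrame σ η)
    (hρ : IsUnitaryFamily ρ) (hσ : IsUnitaryFamily σ)
    (A : E →L[ℝ] F) (B : F →L[ℝ] E)
    (hA : ∀ g x, A (ρ g x) = σ g (A x)) (hB : ∀ g x, B (σ g x) = ρ g (B x)) :
    ∑ i, ⟪B (A (ξ i)), ξ i⟫_ℝ = ∑ j, ⟪A (B (η j)), η j⟫_ℝ := by
  have h1 : HasSum (fun g => ∑ j, ∑ i, ⟪B (η j), ρ g (ξ i)⟫_ℝ * ⟪A (ρ g (ξ i)), η j⟫_ℝ)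
      (∑ j, ⟪A (B (η j)), η j⟫_ℝ) := by
    refine hasSum_sum fun j _ => ?_
    simpa only [adjoint_inner_right] using hξ (B (η j)) (adjoint A (η j))
  have h2 : HasSum (fun g => ∑ i, ∑ j, ⟪A (ξ i), σ g (η j)⟫_ℝ * ⟪B (σ g (η j)), ξ i⟫_ℝ)
      (∑ i, ⟪B (A (ξ i)), ξ i⟫_ℝ) := by
    refine hasSum_sum fun i _ => ?_
    simpa only [adjoint_inner_right] using hη (A (ξ i)) (adjoint B (ξ i))
  rw [← (Equiv.inv K).hasSum_iff] at h1
  refine h2.unique ?_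
  convert h1 using 2 with g
  simp only [Function.comp_apply, Equiv.inv_apply]
  rw [Finset.sum_comm]
  refine Finset.sum_congr rfl fun j _ => Finset.sum_congr rfl fun i _ => ?_
  rw [hA, hσ, inv_inv, hB, hρ, mul_comm]

lemma exists_resolvent [CompleteSpace E] [CompleteSpace F] (T : E →L[ℝ] F) {ε : ℝ} (hε : 0 < ε) :
    ∃ S : E →L[ℝ] E, (∀ x, adjoint T (T (S x)) + ε • S x = x) ∧
      ∀ x, S (adjoint T (T x) + ε • x) = x := by
  have hB : IsCoercive ((innerSL ℝ).comp
      ((adjoint T).comp T + ε • ContinuousLinearMap.id ℝ E)) := by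
    refine ⟨ε, hε, fun x => ?_⟩
    have h : ⟪adjoint T (T x), x⟫_ℝ = ‖T x‖ * ‖T x‖ := by
      rw [adjoint_inner_left, real_inner_self_eq_norm_mul_norm]
    simp only [ContinuousLinearMap.comp_apply, innerSL_apply_apply, _root_.add_apply,
      _root_.smul_apply, ContinuousLinearMap.id_apply, inner_add_left,
      real_inner_smul_left, real_inner_self_eq_norm_mul_norm, h]
    nlinarith [mul_self_nonneg ‖T x‖]
  have key : ∀ x, hB.continuousLinearEquivOfBilin x = adjoint T (T x) + ε • x := fun x =>
    ext_inner_right ℝ fun w => by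
      rw [hB.continuousLinearEquivOfBilin_apply]
      rfl
  refine ⟨hB.continuousLinearEquivOfBilin.symm, fun x => ?_, fun x => ?_⟩
  · have := key (hB.continuousLinearEquivOfBilin.symm x)
    simpa using this.symm
  · rw [← key]
    exact hB.continuousLinearEquivOfBilin.symm_apply_apply x

/-- Energy identity for solutions of `(T† T + ε) z = x`. -/
lemma norm_sq_add_eq_inner [CompleteSpace E] [CompleteSpace F] {T : E →L[ℝ] F} {ε : ℝ} {x z : E}
    (h : adjoint T (T z) + ε • z = x) : ‖T z‖ ^ 2 + ε * ‖z‖ ^ 2 = ⟪x, z⟫_ℝ := by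
  rw [← h, inner_add_left, adjoint_inner_left, real_inner_smul_left,
    real_inner_self_eq_norm_sq, real_inner_self_eq_norm_sq]

lemma norm_smul_le_of_resolvent [CompleteSpace E] [CompleteSpace F] {T : E →L[ℝ] F} {ε : ℝ}
    (hε : 0 < ε) {x z : E} (h : adjoint T (T z) + ε • z = x) : ‖ε • z‖ ≤ ‖x‖ := by
  have h1 := norm_sq_add_eq_inner h
  have h2 := real_inner_le_norm x z
  rw [norm_smul, Real.norm_of_nonneg hε.le]
  by_contra! h3
  have hz : 0 < ‖z‖ := by
    by_contra! hz
    have : ‖z‖ = 0 := le_antisymm hz (norm_nonneg z)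
    rw [this] at h3
    linarith [norm_nonneg x]
  nlinarith [mul_lt_mul_of_pos_right h3 hz, sq_nonneg ‖T z‖]

lemma norm_apply_le_of_resolvent_adjoint [CompleteSpace E] [CompleteSpace F] {T : E →L[ℝ] F}
    {ε : ℝ} (hε : 0 < ε) {y : F} {z : E} (h : adjoint T (T z) + ε • z = adjoint T y) :
    ‖T z‖ ≤ ‖y‖ ∧ ε * ‖z‖ ^ 2 ≤ ‖y‖ ^ 2 := by
  have h1 := norm_sq_add_eq_inner h
  rw [adjoint_inner_left] at h1
  have h2 := real_inner_le_norm y (T z)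
  have h3 : 0 ≤ ε * ‖z‖ ^ 2 := by positivity
  have h4 : ‖T z‖ ≤ ‖y‖ := by
    by_contra! h4
    nlinarith [norm_nonneg y]
  exact ⟨h4, by nlinarith [norm_nonneg y, norm_nonneg (T z), sq_nonneg ‖T z‖]⟩

lemma exists_norm_sub_adjoint_lt [CompleteSpace E] [CompleteSpace F] {T : E →L[ℝ] F}
    (hT : Function.Injective T) (x : E) {δ : ℝ} (hδ : 0 < δ) : ∃ y, ‖x - adjoint T y‖ < δ := by
  have hx : x ∈ (adjoint T).range.topologicalClosure := by
    rw [← Submodule.orthogonal_orthogonal_eq_closure, ContinuousLinearMap.orthogonal_range,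
      adjoint_adjoint, LinearMap.ker_eq_bot.2 hT]
    simp
  obtain ⟨_, ⟨y, rfl⟩, hy⟩ := Metric.mem_closure_iff.1 hx δ hδ
  exact ⟨y, by simpa [dist_eq_norm] using hy⟩

lemma tendsto_smul_resolvent [CompleteSpace E] [CompleteSpace F] {T : E →L[ℝ] F}
    (hT : Function.Injective T) {S : ℝ → E →L[ℝ] E}
    (hS : ∀ ε, 0 < ε → ∀ x, adjoint T (T (S ε x)) + ε • S ε x = x) (x : E) :
    Tendsto (fun ε => ε • S ε x) (𝓝[>] 0) (𝓝 0) := by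
  rw [Metric.tendsto_nhds]
  intro δ hδ
  obtain ⟨y, hy⟩ := exists_norm_sub_adjoint_lt hT x (half_pos hδ)
  have hlim : Tendsto (fun ε : ℝ => √ε * ‖y‖) (𝓝[>] 0) (𝓝 0) := by
    have : Tendsto (fun ε : ℝ => √ε * ‖y‖) (𝓝 0) (𝓝 (√0 * ‖y‖)) :=
      (by fun_prop : Continuous fun ε : ℝ => √ε * ‖y‖).tendsto 0
    simpa using this.mono_left nhdsWithin_le_nhds
  filter_upwards [hlim.eventually (gt_mem_nhds (half_pos hδ)), self_mem_nhdsWithin] with ε h1 hε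
  replace hε : 0 < ε := hε
  have h2 : ‖ε • S ε (x - adjoint T y)‖ ≤ ‖x - adjoint T y‖ :=
    norm_smul_le_of_resolvent hε (hS ε hε _)
  have h3 : ‖ε • S ε (adjoint T y)‖ ≤ √ε * ‖y‖ := by
    have := (norm_apply_le_of_resolvent_adjoint hε (hS ε hε (adjoint T y))).2
    rw [norm_smul, Real.norm_of_nonneg hε.le]
    refine abs_le_of_sq_le_sq' ?_ (by positivity) |>.2
    rw [mul_pow, mul_pow, Real.sq_sqrt hε.le, sq ε, mul_assoc]
    exact mul_le_mul_of_nonneg_left this hε.le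
  have h4 : ε • S ε x = ε • S ε (x - adjoint T y) + ε • S ε (adjoint T y) := by
    rw [← smul_add, ← map_add, sub_add_cancel]
  rw [dist_zero_right, h4]
  linarith [norm_add_le (ε • S ε (x - adjoint T y)) (ε • S ε (adjoint T y))]

/-- Monotonicity of the von Neumann dimension along injective equivariant operators. -/
theorem IsParsevalFrame.sum_norm_sq_le [CompleteSpace E] [CompleteSpace F]
    {ρ : K → E →L[ℝ] E} {σ : K → F →L[ℝ] F} {ξ : ι → E} {η : κ → F}
    (hξ : IsParsevalFrame ρ ξ) (hη : IsParsevalFrame σ η)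
    (hρ : IsUnitaryFamily ρ) (hσ : IsUnitaryFamily σ)
    (T : E →L[ℝ] F) (hT : Function.Injective T) (hTeq : ∀ g x, T (ρ g x) = σ g (T x)) :
    ∑ i, ‖ξ i‖ ^ 2 ≤ ∑ j, ‖η j‖ ^ 2 := by
  have hex : ∀ ε : ℝ, ∃ S : E →L[ℝ] E, 0 < ε →
      (∀ x, adjoint T (T (S x)) + ε • S x = x) ∧ ∀ x, S (adjoint T (T x) + ε • x) = x := by
    intro ε
    by_cases hε : 0 < ε
    · obtain ⟨S, hS⟩ := exists_resolvent T hε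
      exact ⟨S, fun _ => hS⟩
    · exact ⟨0, fun h => absurd h hε⟩
  choose S hS using hex
  have hT' : ∀ g y, adjoint T (σ g y) = ρ g (adjoint T y) := fun g y =>
    ext_inner_right ℝ fun x => by
      rw [adjoint_inner_left, hσ, ← hTeq, hρ, adjoint_inner_left]
  have hSeq : ∀ ε, 0 < ε → ∀ g x, S ε (ρ g x) = ρ g (S ε x) := by
    intro ε hε g x
    conv_lhs => rw [← (hS ε hε).1 x]
    rw [map_add, map_smul, ← hT', ← hTeq]
    exact (hS ε hε).2 _
  have hle : ∀ ε, 0 < ε → ∑ i, (‖ξ i‖ ^ 2 - ⟪ε • S ε (ξ i), ξ i⟫_ℝ) ≤ ∑ j, ‖η j‖ ^ 2 := by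
    intro ε hε
    have h1 := hξ.sum_inner_comp_comm hη hρ hσ T ((S ε).comp (adjoint T)) hTeq
      (fun g x => by simp only [ContinuousLinearMap.comp_apply, hT', hSeq ε hε])
    have h2 : ∀ x, ((S ε).comp (adjoint T)) (T x) = x - ε • S ε x := fun x => by
      have := (hS ε hε).2 x
      rw [map_add, map_smul] at this
      exact eq_sub_of_add_eq this
    simp only [h2, inner_sub_left, real_inner_self_eq_norm_sq] at h1
    rw [h1]
    refine Finset.sum_le_sum fun j _ => ?_
    have h3 := (norm_apply_le_of_resolvent_adjoint hε ((hS ε hε).1 (adjoint T (η j)))).1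
    calc _ ≤ _ := real_inner_le_norm _ _
      _ ≤ _ := by
        rw [sq]
        exact mul_le_mul_of_nonneg_right h3 (norm_nonneg _)
  have hlim : Tendsto (fun ε => ∑ i, (‖ξ i‖ ^ 2 - ⟪ε • S ε (ξ i), ξ i⟫_ℝ)) (𝓝[>] 0)
      (𝓝 (∑ i, (‖ξ i‖ ^ 2 - ⟪(0 : E), ξ i⟫_ℝ))) :=
    tendsto_finsetSum _ fun i _ => tendsto_const_nhds.sub
      ((tendsto_smul_resolvent hT (fun ε hε => (hS ε hε).1) (ξ i)).inner tendsto_const_nhds)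
  simp only [inner_zero_left, sub_zero] at hlim
  refine le_of_tendsto hlim ?_
  filter_upwards [self_mem_nhdsWithin] with ε hε using hle ε hε

end EquivariantTrace

section Coefficients

open scoped InnerProductSpace

lemma IsParsevalFrame.diagonal {K V : Type*} [Group K] [NormedAddCommGroup V]
    [InnerProductSpace ℝ V] {ρ : K → V →L[ℝ] V} {ξ : V}
    (hξ : IsParsevalFrame ρ fun _ : Unit => ξ) (ι : Type*) [Fintype ι] [DecidableEq ι]
    {R : K → PiLp 2 (fun _ : ι => V) →L[ℝ] PiLp 2 (fun _ : ι => V)}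
    (hR : ∀ g x i, R g x i = ρ g (x i)) :
    IsParsevalFrame R fun i => (PiLp.single 2 i ξ : PiLp 2 fun _ : ι => V) := by
  have h : ∀ (x : PiLp 2 fun _ : ι => V) g i,
      ⟪x, R g (PiLp.single 2 i ξ)⟫_ℝ = ⟪x i, ρ g ξ⟫_ℝ := by
    intro x g i
    rw [PiLp.inner_apply, Finset.sum_eq_single i]
    · simp [hR]
    · intro j _ hj
      simp [hR, hj]
    · simp
  intro x y
  simp only [real_inner_comm _ (R _ _), h, PiLp.inner_apply]
  refine hasSum_sum fun i _ => ?_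
  simpa [real_inner_comm] using hξ (x i) (y i)

/-- The diagonal operator on a finite Hilbert sum of copies of `V`. -/
noncomputable def diagonalOperator {V : Type*} [NormedAddCommGroup V] [InnerProductSpace ℝ V]
    (ι : Type*) [Fintype ι] (A : V →L[ℝ] V) :
    PiLp 2 (fun _ : ι => V) →L[ℝ] PiLp 2 (fun _ : ι => V) :=
  (PiLp.continuousLinearEquiv 2 ℝ fun _ : ι => V).symm.toContinuousLinearMap.comp <|
    (ContinuousLinearMap.pi fun i => A.comp (ContinuousLinearMap.proj i)).comp
      (PiLp.continuousLinearEquiv 2 ℝ fun _ : ι => V).toContinuousLinearMap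

@[simp]
lemma diagonalOperator_apply {V : Type*} [NormedAddCommGroup V] [InnerProductSpace ℝ V]
    {ι : Type*} [Fintype ι] (A : V →L[ℝ] V) (x : PiLp 2 fun _ : ι => V) (i : ι) :
    diagonalOperator ι A x i = A (x i) := rfl

lemma IsUnitaryFamily.diagonalOperator {K V : Type*} [Group K] [NormedAddCommGroup V]
    [InnerProductSpace ℝ V] {ρ : K → V →L[ℝ] V} (hρ : IsUnitaryFamily ρ) (ι : Type*) [Fintype ι] :
    IsUnitaryFamily fun g => _root_.diagonalOperator (V := V) ι (ρ g) := fun g x y => by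
  simp only [PiLp.inner_apply, diagonalOperator_apply]
  exact Finset.sum_congr rfl fun i _ => hρ g _ _

/-- Dimension comparison for finite powers of a Hilbert module generated by one vector. -/
theorem card_le_card_of_injective {K V : Type*} [Group K] [NormedAddCommGroup V]
    [InnerProductSpace ℝ V] [CompleteSpace V] {ρ : K → V →L[ℝ] V} {ξ : V}
    (hξ : IsParsevalFrame ρ fun _ : Unit => ξ) (hρ : IsUnitaryFamily ρ) (hξ0 : ξ ≠ 0)
    {ι κ : Type*} [Fintype ι] [Fintype κ]
    (T : PiLp 2 (fun _ : ι => V) →L[ℝ] PiLp 2 (fun _ : κ => V)) (hT : Function.Injective T)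
    (hTeq : ∀ g x, T (diagonalOperator ι (ρ g) x) = diagonalOperator κ (ρ g) (T x)) :
    Fintype.card ι ≤ Fintype.card κ := by
  classical
  have h := (hξ.diagonal ι (R := fun g => diagonalOperator ι (ρ g)) fun _ _ _ => rfl).sum_norm_sq_le
    (hξ.diagonal κ (R := fun g => diagonalOperator κ (ρ g)) fun _ _ _ => rfl)
    (hρ.diagonalOperator ι) (hρ.diagonalOperator κ) T hT hTeq
  have hpos : 0 < ‖ξ‖ ^ 2 := by positivity
  simp only [PiLp.norm_single, Finset.sum_const, nsmul_eq_mul, Finset.card_univ] at h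
  exact_mod_cast le_of_mul_le_mul_right h hpos

end Coefficients

section SumElim

variable {α β : Type*} {A : α → Type u} {B : β → Type u}
  [∀ a, Group (A a)] [∀ b, Group (B b)] {N : Type*} [Monoid N]

/-- The inclusion of a factor of the first family. -/
def ofInl (a : α) : A a →* CoprodI (Sum.elim A B) :=
  CoprodI.of (M := Sum.elim A B) (i := Sum.inl a)

/-- The inclusion of a factor of the second family. -/
def ofInr (b : β) : B b →* CoprodI (Sum.elim A B) :=
  CoprodI.of (M := Sum.elim A B) (i := Sum.inr b)

/-- The universal property of a free product over a sum of two families. -/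
def sumElimLift (f : ∀ a, A a →* N) (g : ∀ b, B b →* N) : CoprodI (Sum.elim A B) →* N :=
  CoprodI.lift fun i => match i with
    | .inl a => f a
    | .inr b => g b

@[simp]
lemma sumElimLift_ofInl (f : ∀ a, A a →* N) (g : ∀ b, B b →* N) (a : α) (x : A a) :
    sumElimLift f g (ofInl a x) = f a x :=
  CoprodI.lift_of (M := Sum.elim A B) (i := Sum.inl a) _ x

@[simp]
lemma sumElimLift_ofInr (f : ∀ a, A a →* N) (g : ∀ b, B b →* N) (b : β) (x : B b) :
    sumElimLift f g (ofInr b x) = g b x :=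
  CoprodI.lift_of (M := Sum.elim A B) (i := Sum.inr b) _ x

lemma sumElim_induction {motive : CoprodI (Sum.elim A B) → Prop} (one : motive 1)
    (inl : ∀ a x, motive (ofInl a x)) (inr : ∀ b x, motive (ofInr b x))
    (mul : ∀ x y, motive x → motive y → motive (x * y)) (x : CoprodI (Sum.elim A B)) :
    motive x :=
  CoprodI.induction_on x one
    (fun i => match i with
      | .inl a => inl a
      | .inr b => inr b) mul

end SumElim

section AffineAction

variable {V : Type*} [NormedAddCommGroup V] [InnerProductSpace ℝ V]
  {m q : ℕ} {Hf : Fin m → Type} [∀ j, Group (Hf j)]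

/-- The parameter space of affine actions of a free product: one base point for each factor and
one translation vector for each free generator. -/
abbrev AffineParam (V : Type*) (m q : ℕ) : Type _ := PiLp 2 fun _ : Fin m ⊕ Fin q => V

/-- The coordinate projection on the parameter space. -/
noncomputable abbrev paramProj (i : Fin m ⊕ Fin q) : AffineParam V m q →L[ℝ] V :=
  PiLp.proj 2 (fun _ : Fin m ⊕ Fin q => V) i

/-- The affine action `x ↦ L (x - v) + v` of a factor, where the base point `v` is a coordinate of
the parameter. -/
noncomputable def factorAction (L : ∀ j, Hf j →* (V →L[ℝ] V)) (j : Fin m) :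
    Hf j →* (AffineParam V m q × V →L[ℝ] AffineParam V m q × V) where
  toFun h := (ContinuousLinearMap.fst ℝ _ _).prod
    ((L j h).comp (ContinuousLinearMap.snd ℝ _ _ -
      (paramProj (Sum.inl j)).comp (ContinuousLinearMap.fst ℝ _ _)) +
      (paramProj (Sum.inl j)).comp (ContinuousLinearMap.fst ℝ _ _))
  map_one' := by
    refine ContinuousLinearMap.ext fun x => ?_
    simp
  map_mul' a b := by
    refine ContinuousLinearMap.ext fun x => ?_
    simp

/-- The action of a free generator by translations. -/
noncomputable def translationAction (l : Fin q) :
    Multiplicative ℤ →* (AffineParam V m q × V →L[ℝ] AffineParam V m q × V) where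
  toFun z := (ContinuousLinearMap.fst ℝ _ _).prod
    (ContinuousLinearMap.snd ℝ _ _ +
      (z.toAdd : ℝ) • (paramProj (Sum.inr l)).comp (ContinuousLinearMap.fst ℝ _ _))
  map_one' := by
    refine ContinuousLinearMap.ext fun x => ?_
    simp
  map_mul' a b := by
    refine ContinuousLinearMap.ext fun x => ?_
    simp [add_smul, add_comm, add_left_comm]

/-- The universal family of affine actions of a free product on `V`. -/
noncomputable def affineAction (L : ∀ j, Hf j →* (V →L[ℝ] V)) :
    CoprodI (Sum.elim Hf fun _ : Fin q => Multiplicative ℤ) →*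
      (AffineParam V m q × V →L[ℝ] AffineParam V m q × V) :=
  sumElimLift (factorAction L) translationAction

variable (L : ∀ j, Hf j →* (V →L[ℝ] V))

lemma affineAction_ofInl (j : Fin m) (h : Hf j) (x : AffineParam V m q × V) :
    affineAction L (ofInl j h) x =
      (x.1, L j h (x.2 - x.1 (Sum.inl j)) + x.1 (Sum.inl j)) := by
  rw [affineAction, sumElimLift_ofInl]
  rfl

lemma affineAction_ofInr (l : Fin q) (z : Multiplicative ℤ) (x : AffineParam V m q × V) :
    affineAction L (ofInr l z) x = (x.1, x.2 + (z.toAdd : ℝ) • x.1 (Sum.inr l)) := by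
  rw [affineAction, sumElimLift_ofInr]
  rfl

lemma affineAction_fst (g : CoprodI (Sum.elim Hf fun _ : Fin q => Multiplicative ℤ)) :
    ∀ x, (affineAction L g x).1 = x.1 := by
  induction g using sumElim_induction with
  | one => simp
  | inl j h => simp [affineAction_ofInl]
  | inr l z => simp [affineAction_ofInr]
  | mul a b ha hb => intro x; simp [ha, hb]

lemma affineAction_comm {A : V →L[ℝ] V} (hA : ∀ j h x, L j h (A x) = A (L j h x))
    (g : CoprodI (Sum.elim Hf fun _ : Fin q => Multiplicative ℤ)) :
    ∀ x, affineAction L g (diagonalOperator _ A x.1, A x.2) =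
      (diagonalOperator _ A (affineAction L g x).1, A (affineAction L g x).2) := by
  induction g using sumElim_induction with
  | one => simp
  | inl j h =>
    intro x
    simp only [affineAction_ofInl, diagonalOperator_apply, ← map_sub, hA, map_add]
  | inr l z => simp [affineAction_ofInr]
  | mul a b ha hb => intro x; simp [ha, hb]

/-- The elements acting on the slice over `e` with fixed point `x`. -/
def affineStabilizer (e : AffineParam V m q) (x : V) :
    Subgroup (CoprodI (Sum.elim Hf fun _ : Fin q => Multiplicative ℤ)) where
  carrier := {g | affineAction L g (e, x) = (e, x)}
  one_mem' := by simp
  mul_mem' {a b} ha hb := by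
    simp only [Set.mem_ofPred_eq] at *
    rw [map_mul, mul_apply_eq_comp, hb, ha]
  inv_mem' {a} ha := by
    simp only [Set.mem_ofPred_eq] at *
    conv_lhs => rw [← ha]
    rw [← mul_apply_eq_comp, ← map_mul, inv_mul_cancel, map_one,
      one_apply_eq_self]

lemma mem_affineStabilizer {e : AffineParam V m q} {x : V}
    {g : CoprodI (Sum.elim Hf fun _ : Fin q => Multiplicative ℤ)} :
    g ∈ affineStabilizer L e x ↔ affineAction L g (e, x) = (e, x) := Iff.rfl

lemma eq_zero_of_affineStabilizer_eq_top
    (hL : ∀ j x, (∀ h, L j h x = x) → x = 0) {e : AffineParam V m q}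
    (he : affineStabilizer L e 0 = ⊤) : e = 0 := by
  have h : ∀ g, affineAction L g (e, 0) = (e, 0) := fun g =>
    (mem_affineStabilizer L).1 (he ▸ Subgroup.mem_top g)
  ext i
  match i with
  | .inl j =>
    refine hL j _ fun a => ?_
    have := congrArg Prod.snd ((affineAction_ofInl L j a (e, 0)).symm.trans (h _))
    simp only [zero_sub, map_neg, neg_add_eq_zero] at this
    exact this
  | .inr l =>
    have := congrArg Prod.snd
      ((affineAction_ofInr L l (Multiplicative.ofAdd 1) (e, 0)).symm.trans (h _))
    simpa using this

lemma conj_of_mem_affineStabilizer {e : AffineParam V m q} {x : V} {j : Fin m}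
    {g : CoprodI (Sum.elim Hf fun _ : Fin q => Multiplicative ℤ)}
    (hg : (affineAction L g (e, e (Sum.inl j))).2 = x) :
    conjSubgroup g (factorSubgroup (Sum.inl j)) ≤ affineStabilizer L e x := by
  rintro _ ⟨_, ⟨h, rfl⟩, rfl⟩
  have hg' : affineAction L g (e, e (Sum.inl j)) = (e, x) :=
    Prod.ext (affineAction_fst L g _) hg
  have hinv : affineAction L g⁻¹ (e, x) = (e, e (Sum.inl j)) := by
    rw [← hg', ← mul_apply_eq_comp, ← map_mul, inv_mul_cancel, map_one,
      one_apply_eq_self]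
  have hh : affineAction L (ofInl j h) (e, e (Sum.inl j)) =
      (e, e (Sum.inl j)) :=
    (affineAction_ofInl L j h _).trans (by simp)
  change affineAction L (g * ofInl j h * g⁻¹) (e, x) = (e, x)
  simp only [map_mul, mul_apply_eq_comp]
  rw [hinv, hh, hg']

end AffineAction

section RegularRepresentation

open scoped InnerProductSpace

variable {K : Type*}

/-- The isometry of `ℓ²(K)` induced by a permutation of `K`. -/
noncomputable def permIsometry (σ : Equiv.Perm K) :
    lp (fun _ : K => ℝ) 2 →ₗᵢ[ℝ] lp (fun _ : K => ℝ) 2 where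
  toFun f := ⟨fun x => f (σ.symm x), by
    have h := lp.memℓp f
    rw [memℓp_gen_iff (by norm_num)] at h
    refine (memℓp_gen_iff (by norm_num)).2 ?_
    exact h.comp_injective σ.symm.injective⟩
  map_add' _ _ := rfl
  map_smul' _ _ := rfl
  norm_map' f := by
    rw [← sq_eq_sq₀ (norm_nonneg _) (norm_nonneg _), ← real_inner_self_eq_norm_sq,
      ← real_inner_self_eq_norm_sq, lp.inner_eq_tsum, lp.inner_eq_tsum]
    exact σ.symm.tsum_eq fun x => ⟪f x, f x⟫_ℝ

@[simp]
lemma permIsometry_apply (σ : Equiv.Perm K) (f : lp (fun _ : K => ℝ) 2) (x : K) :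
    permIsometry σ f x = f (σ.symm x) := rfl

lemma inner_permIsometry (σ : Equiv.Perm K) (f g : lp (fun _ : K => ℝ) 2) :
    ⟪permIsometry σ f, g⟫_ℝ = ⟪f, permIsometry σ.symm g⟫_ℝ := by
  rw [← (permIsometry σ).inner_map_map f]
  congr 1
  ext x
  simp

variable [Group K]

/-- The left regular representation. -/
noncomputable def leftReg (g : K) : lp (fun _ : K => ℝ) 2 →ₗᵢ[ℝ] lp (fun _ : K => ℝ) 2 :=
  permIsometry (Equiv.mulLeft g)

/-- The right regular representation. -/
noncomputable def rightReg (g : K) : lp (fun _ : K => ℝ) 2 →ₗᵢ[ℝ] lp (fun _ : K => ℝ) 2 :=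
  permIsometry (Equiv.mulRight g⁻¹)

@[simp]
lemma leftReg_apply (g : K) (f : lp (fun _ : K => ℝ) 2) (x : K) :
    leftReg g f x = f (g⁻¹ * x) := rfl

@[simp]
lemma rightReg_apply (g : K) (f : lp (fun _ : K => ℝ) 2) (x : K) :
    rightReg g f x = f (x * g) := by
  simp [rightReg]

lemma leftReg_mul (g h : K) (f : lp (fun _ : K => ℝ) 2) :
    leftReg (g * h) f = leftReg g (leftReg h f) := by
  ext x
  simp [mul_assoc]

lemma leftReg_rightReg (g h : K) (f : lp (fun _ : K => ℝ) 2) :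
    leftReg g (rightReg h f) = rightReg h (leftReg g f) := by
  ext x
  simp [mul_assoc]

lemma inner_leftReg (g : K) (f f' : lp (fun _ : K => ℝ) 2) :
    ⟪leftReg g f, f'⟫_ℝ = ⟪f, leftReg g⁻¹ f'⟫_ℝ := by
  rw [leftReg, inner_permIsometry]
  congr 1
  ext x
  simp

lemma inner_rightReg (g : K) (f f' : lp (fun _ : K => ℝ) 2) :
    ⟪rightReg g f, f'⟫_ℝ = ⟪f, rightReg g⁻¹ f'⟫_ℝ := by
  rw [rightReg, inner_permIsometry]
  congr 1
  ext x
  simp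

/-- The restriction of an operator to an invariant subspace. -/
noncomputable def restrictOperator {E : Type*} [NormedAddCommGroup E] [NormedSpace ℝ E]
    (W : Submodule ℝ E) (A : E →ₗᵢ[ℝ] E) (hA : ∀ x ∈ W, A x ∈ W) : W →L[ℝ] W :=
  (A.toContinuousLinearMap.comp W.subtypeL).codRestrict W fun x => hA x x.2

@[simp]
lemma coe_restrictOperator {E : Type*} [NormedAddCommGroup E] [NormedSpace ℝ E]
    (W : Submodule ℝ E) (A : E →ₗᵢ[ℝ] E) (hA : ∀ x ∈ W, A x ∈ W) (x : W) :
    (restrictOperator W A hA x : E) = A x := rfl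

/-- The delta function at the identity generates every right-invariant subspace of `ℓ²(K)`. -/
lemma exists_isParsevalFrame (W : Submodule ℝ (lp (fun _ : K => ℝ) 2)) [CompleteSpace W]
    (hW : ∀ g, ∀ x ∈ W, rightReg g x ∈ W) {w : lp (fun _ : K => ℝ) 2} (hw : w ∈ W)
    (hw0 : w ≠ 0) :
    ∃ ξ : W, ξ ≠ 0 ∧
      IsParsevalFrame (fun g => restrictOperator W (rightReg g) (hW g)) fun _ : Unit => ξ := by
  classical
  let δ : lp (fun _ : K => ℝ) 2 := lp.single 2 (1 : K) (1 : ℝ)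
  have hξ : ∀ (x : W) g,
      ⟪x, restrictOperator W (rightReg g) (hW g) (W.orthogonalProjectionOnto δ)⟫_ℝ =
        (x : lp (fun _ : K => ℝ) 2) g⁻¹ := by
    intro x g
    have h : ∀ y : W, ⟪x, restrictOperator W (rightReg g) (hW g) y⟫_ℝ =
        ⟪(⟨rightReg g⁻¹ x, hW _ _ x.2⟩ : W), y⟫_ℝ := fun y => by
      rw [Submodule.coe_inner, coe_restrictOperator, real_inner_comm, inner_rightReg,
        real_inner_comm, Submodule.coe_inner]
    rw [h, Submodule.inner_orthogonalProjectionOnto_eq_of_mem_left, lp.inner_single_right]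
    simp
  refine ⟨W.orthogonalProjectionOnto δ, fun h0 => hw0 ?_, fun x y => ?_⟩
  · ext g
    have := hξ ⟨w, hw⟩ g⁻¹
    rw [h0, map_zero, inner_zero_right, inv_inv] at this
    simpa using this.symm
  · simp only [Finset.univ_unique, Finset.sum_singleton, real_inner_comm y, hξ]
    rw [real_inner_comm, Submodule.coe_inner]
    have := lp.hasSum_inner (𝕜 := ℝ) (x : lp (fun _ : K => ℝ) 2) y
    rw [← (Equiv.inv K).hasSum_iff] at this
    simpa [Function.comp_def, mul_comm] using this

end RegularRepresentation

section ProductGroup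

open scoped InnerProductSpace

variable {ι : Type*} [DecidableEq ι] {Hf : ι → Type*} [∀ j, Group (Hf j)]

/-- The vectors of `ℓ²(∏ H_j)` that are invariant under some factor. -/
def factorInvariants (Hf : ι → Type*) [∀ j, Group (Hf j)] :
    Set (lp (fun _ : (∀ j, Hf j) => ℝ) 2) :=
  {v | ∃ j, ∀ h : Hf j, leftReg (Pi.mulSingle j h) v = v}

/-- The largest subrepresentation of `ℓ²(∏ H_j)` in which no factor has an invariant vector. -/
noncomputable def reducedRegular (Hf : ι → Type*) [∀ j, Group (Hf j)] :
    Submodule ℝ (lp (fun _ : (∀ j, Hf j) => ℝ) 2) :=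
  (Submodule.span ℝ (factorInvariants Hf))ᗮ

lemma mem_reducedRegular {x : lp (fun _ : (∀ j, Hf j) => ℝ) 2} :
    x ∈ reducedRegular Hf ↔ ∀ v ∈ factorInvariants Hf, ⟪x, v⟫_ℝ = 0 := by
  rw [reducedRegular, Submodule.mem_orthogonal']
  refine ⟨fun h v hv => h v (Submodule.subset_span hv), fun h u hu => ?_⟩
  induction hu using Submodule.span_induction with
  | mem v hv => exact h v hv
  | zero => exact inner_zero_right _
  | add u v _ _ hu hv => rw [inner_add_right, hu, hv, add_zero]
  | smul c u _ hu => rw [real_inner_smul_right, hu, mul_zero]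

lemma leftReg_mem_factorInvariants (i : ι) (a : Hf i)
    {v : lp (fun _ : (∀ j, Hf j) => ℝ) 2} {j : ι}
    (hv : ∀ h : Hf j, leftReg (Pi.mulSingle j h) v = v) (h : Hf j) :
    leftReg (Pi.mulSingle j h) (leftReg (Pi.mulSingle i a) v) = leftReg (Pi.mulSingle i a) v := by
  rcases eq_or_ne i j with rfl | hij
  · rw [hv, hv]
  · rw [← leftReg_mul, ← (Pi.mulSingle_commute hij a h).eq, leftReg_mul, hv]

lemma leftReg_mem_reducedRegular (i : ι) (a : Hf i) {x : lp (fun _ : (∀ j, Hf j) => ℝ) 2}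
    (hx : x ∈ reducedRegular Hf) : leftReg (Pi.mulSingle i a) x ∈ reducedRegular Hf := by
  rw [mem_reducedRegular] at hx ⊢
  rintro v ⟨j, hv⟩
  rw [inner_leftReg, ← Pi.mulSingle_inv]
  exact hx _ ⟨j, leftReg_mem_factorInvariants i _ hv⟩

lemma rightReg_mem_reducedRegular (g : ∀ j, Hf j) {x : lp (fun _ : (∀ j, Hf j) => ℝ) 2}
    (hx : x ∈ reducedRegular Hf) : rightReg g x ∈ reducedRegular Hf := by
  rw [mem_reducedRegular] at hx ⊢
  rintro v ⟨j, hv⟩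
  rw [inner_rightReg]
  exact hx _ ⟨j, fun h => by rw [leftReg_rightReg, hv]⟩

lemma exists_mem_reducedRegular_ne_zero [Fintype ι] [∀ j, Nontrivial (Hf j)] :
    ∃ w ∈ reducedRegular Hf, w ≠ 0 := by
  classical
  have key : ∀ s : Finset ι, ∃ u : lp (fun _ : (∀ j, Hf j) => ℝ) 2, u 1 ≠ 0 ∧
      (∀ j ∉ s, ∀ k : ∀ j, Hf j, k j ≠ 1 → u k = 0) ∧
      ∀ j ∈ s, ∀ v, (∀ h : Hf j, leftReg (Pi.mulSingle j h) v = v) → ⟪u, v⟫_ℝ = 0 := by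
    intro s
    induction s using Finset.induction_on with
    | empty =>
      refine ⟨lp.single 2 1 (1 : ℝ), by simp, fun j _ k hk => ?_, by simp⟩
      exact lp.single_apply_ne 2 _ _ fun h => hk (by rw [h, Pi.one_apply])
    | insert i s hi ih =>
      obtain ⟨u, hu1, hu2, hu3⟩ := ih
      obtain ⟨a, ha⟩ := exists_ne (1 : Hf i)
      refine ⟨leftReg (Pi.mulSingle i a) u - u, ?_, fun j hj k hk => ?_, fun j hj v hv => ?_⟩
      · rw [lp.coeFn_sub, Pi.sub_apply, leftReg_apply, hu2 i hi, zero_sub]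
        · exact neg_ne_zero.2 hu1
        · simpa using ha
      · rw [Finset.mem_insert, not_or] at hj
        rw [lp.coeFn_sub, Pi.sub_apply, leftReg_apply, hu2 j hj.2 k hk, hu2 j hj.2, sub_zero]
        simpa [Pi.mulSingle_eq_of_ne hj.1] using hk
      · rw [inner_sub_left, inner_leftReg, ← Pi.mulSingle_inv]
        rcases eq_or_ne j i with rfl | hij
        · rw [hv, sub_self]
        · have hjs := Finset.mem_of_mem_insert_of_ne hj hij
          rw [hu3 j hjs _ hv, hu3 j hjs _ (leftReg_mem_factorInvariants i _ hv), sub_zero]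
  obtain ⟨u, hu1, -, hu⟩ := key Finset.univ
  refine ⟨u, mem_reducedRegular.2 ?_, fun h => hu1 (by rw [h]; rfl)⟩
  rintro v ⟨j, hv⟩
  exact hu j (Finset.mem_univ j) v hv

/-- The action of a factor on the reduced regular representation. -/
noncomputable def reducedAction (j : ι) : Hf j →* (reducedRegular Hf →L[ℝ] reducedRegular Hf) where
  toFun h := restrictOperator _ (leftReg (Pi.mulSingle j h))
    fun _ => leftReg_mem_reducedRegular j h
  map_one' := by
    ext x k
    simp
  map_mul' a b := by
    ext x k
    simp [Pi.mulSingle_mul, mul_assoc]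

lemma eq_zero_of_reducedAction_eq (j : ι) (x : reducedRegular Hf)
    (hx : ∀ h, reducedAction j h x = x) : x = 0 := by
  have h : (x : lp (fun _ : (∀ j, Hf j) => ℝ) 2) ∈ factorInvariants Hf :=
    ⟨j, fun h => congrArg Subtype.val (hx h)⟩
  exact Subtype.ext (inner_self_eq_zero.1 (mem_reducedRegular.1 x.2 _ h))

end ProductGroup

section RankInequalities

/-- Counting dimensions for the affine actions on a Hilbert module generated by one vector. -/
theorem add_le_add_of_isParsevalFrame {V K : Type*} [NormedAddCommGroup V]
    [InnerProductSpace ℝ V] [CompleteSpace V] [Group K] {ρ : K → V →L[ℝ] V} {ξ : V}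
    (hξ : IsParsevalFrame ρ fun _ : Unit => ξ) (hρ : IsUnitaryFamily ρ) (hξ0 : ξ ≠ 0)
    {n m p q : ℕ} {Hf : Fin m → Type} [∀ j, Group (Hf j)] (L : ∀ j, Hf j →* (V →L[ℝ] V))
    (hL : ∀ j x, (∀ h, L j h x = x) → x = 0)
    (hcomm : ∀ k j h x, L j h (ρ k x) = ρ k (L j h x)) (J : Fin n → Fin m)
    (g : Fin n → CoprodI (Sum.elim Hf fun _ : Fin q => Multiplicative ℤ))
    (y : Fin p → CoprodI (Sum.elim Hf fun _ : Fin q => Multiplicative ℤ))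
    (hgen : ∀ S : Subgroup (CoprodI (Sum.elim Hf fun _ : Fin q => Multiplicative ℤ)),
      (∀ i, conjSubgroup (g i) (factorSubgroup (Sum.inl (J i))) ≤ S) → (∀ l, y l ∈ S) → S = ⊤) :
    m + q ≤ n + p := by
  let P : Fin n ⊕ Fin p → AffineParam V m q →L[ℝ] V :=
    Sum.elim
      (fun i => (ContinuousLinearMap.snd ℝ _ _).comp ((affineAction L (g i)).comp
        ((ContinuousLinearMap.id ℝ _).prod (paramProj (Sum.inl (J i))))))
      (fun l => (ContinuousLinearMap.snd ℝ _ _).comp ((affineAction L (y l)).comp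
        ((ContinuousLinearMap.id ℝ _).prod 0)))
  let T : AffineParam V m q →L[ℝ] PiLp 2 (fun _ : Fin n ⊕ Fin p => V) :=
    (PiLp.continuousLinearEquiv 2 ℝ fun _ : Fin n ⊕ Fin p => V).symm.toContinuousLinearMap.comp
      (ContinuousLinearMap.pi P)
  have hTl : ∀ e i, T e (Sum.inl i) = (affineAction L (g i) (e, e (Sum.inl (J i)))).2 :=
    fun _ _ => rfl
  have hTr : ∀ e l, T e (Sum.inr l) = (affineAction L (y l) (e, 0)).2 := fun _ _ => rfl
  have hTinj : Function.Injective T := by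
    refine (injective_iff_map_eq_zero T).2 fun e he => ?_
    refine eq_zero_of_affineStabilizer_eq_top L hL
      (hgen _ (fun i => conj_of_mem_affineStabilizer L ?_) fun l => ?_)
    · rw [← hTl, he]
      rfl
    · refine (mem_affineStabilizer L).2 (Prod.ext (affineAction_fst L _ _) ?_)
      rw [← hTr, he]
      rfl
  have hcard := card_le_card_of_injective hξ hρ hξ0 T hTinj fun k e => ?_
  · simpa using hcard
  · ext i
    match i with
    | .inl i =>
      rw [diagonalOperator_apply, hTl, hTl]
      exact congrArg Prod.snd (affineAction_comm L (hcomm k) (g i) (e, e (Sum.inl (J i))))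
    | .inr l =>
      rw [diagonalOperator_apply, hTr, hTr]
      have := congrArg Prod.snd (affineAction_comm L (hcomm k) (y l) (e, 0))
      rwa [map_zero] at this

/-- If a free product of `m` nontrivial groups and a free group of rank `q` is generated by `n`
conjugates of factors and `p` further elements, then `m + q ≤ n + p`. -/
theorem add_le_add_of_generates {n m p q : ℕ} {Hf : Fin m → Type} [∀ j, Group (Hf j)]
    [∀ j, Nontrivial (Hf j)] (J : Fin n → Fin m)
    (g : Fin n → CoprodI (Sum.elim Hf fun _ : Fin q => Multiplicative ℤ))
    (y : Fin p → CoprodI (Sum.elim Hf fun _ : Fin q => Multiplicative ℤ))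
    (hgen : ∀ S : Subgroup (CoprodI (Sum.elim Hf fun _ : Fin q => Multiplicative ℤ)),
      (∀ i, conjSubgroup (g i) (factorSubgroup (Sum.inl (J i))) ≤ S) → (∀ l, y l ∈ S) → S = ⊤) :
    m + q ≤ n + p := by
  obtain ⟨w, hw, hw0⟩ := exists_mem_reducedRegular_ne_zero (Hf := Hf)
  have : CompleteSpace (reducedRegular Hf) := by
    unfold reducedRegular
    infer_instance
  obtain ⟨ξ, hξ0, hξ⟩ := exists_isParsevalFrame (reducedRegular Hf)
    (fun g _ hx => rightReg_mem_reducedRegular g hx) hw hw0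
  exact add_le_add_of_isParsevalFrame hξ (fun k _ _ => inner_rightReg k _ _) hξ0 reducedAction
    eq_zero_of_reducedAction_eq (fun _ _ _ _ => Subtype.ext (leftReg_rightReg _ _ _)) J g y hgen

/-- The projection of a free product onto the abelianization of its free part. -/
def toFreeAbelian {m : ℕ} (Hf : Fin m → Type) [∀ j, Group (Hf j)] (q : ℕ) :
    CoprodI (Sum.elim Hf fun _ : Fin q => Multiplicative ℤ) →* Multiplicative (Fin q → ℤ) :=
  sumElimLift (fun _ => 1) fun l => AddMonoidHom.toMultiplicative
    (AddMonoidHom.single (fun _ : Fin q => ℤ) l)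

lemma conjSubgroup_le_ker_toFreeAbelian {m : ℕ} {Hf : Fin m → Type} [∀ j, Group (Hf j)] {q : ℕ}
    (g : CoprodI (Sum.elim Hf fun _ : Fin q => Multiplicative ℤ)) (j : Fin m) :
    conjSubgroup g (factorSubgroup (Sum.inl j)) ≤ (toFreeAbelian Hf q).ker := by
  rintro _ ⟨_, ⟨h, rfl⟩, rfl⟩
  change toFreeAbelian Hf q (g * ofInl j h * g⁻¹) = 1
  have : toFreeAbelian Hf q (ofInl j h) = 1 := sumElimLift_ofInl _ _ j h
  simp [this]

/-- If the abelianized free part is generated by the images of conjugates of factors and of `p`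
further elements, then its rank is at most `p`. -/
theorem free_rank_le_of_generates {n m p q : ℕ} {Hf : Fin m → Type} [∀ j, Group (Hf j)]
    (J : Fin n → Fin m)
    (g : Fin n → CoprodI (Sum.elim Hf fun _ : Fin q => Multiplicative ℤ))
    (y : Fin p → CoprodI (Sum.elim Hf fun _ : Fin q => Multiplicative ℤ))
    (hgen : ∀ S : Subgroup (CoprodI (Sum.elim Hf fun _ : Fin q => Multiplicative ℤ)),
      (∀ i, conjSubgroup (g i) (factorSubgroup (Sum.inl (J i))) ≤ S) → (∀ l, y l ∈ S) → S = ⊤) :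
    q ≤ p := by
  let f : (Fin p → ℤ) →ₗ[ℤ] (Fin q → ℤ) :=
    Fintype.linearCombination ℤ fun l => (toFreeAbelian Hf q (y l)).toAdd
  refine le_of_fin_surjective ℤ f (LinearMap.range_eq_top.1 ?_)
  let S := (AddSubgroup.toSubgroup f.range.toAddSubgroup).comap (toFreeAbelian Hf q)
  have hS : ∀ x, x ∈ S ↔ (toFreeAbelian Hf q x).toAdd ∈ f.range := fun x => Iff.rfl
  have htop : S = ⊤ := by
    refine hgen S (fun i x hx => ?_) fun l => ?_
    · rw [hS, MonoidHom.mem_ker.1 (conjSubgroup_le_ker_toFreeAbelian _ _ hx)]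
      exact zero_mem _
    · exact ⟨Pi.single l 1, by simp [f]⟩
  rw [eq_top_iff, ← (Pi.basisFun ℤ (Fin q)).span_eq, Submodule.span_le]
  rintro _ ⟨l, rfl⟩
  have hl : toFreeAbelian Hf q (ofInr l (Multiplicative.ofAdd 1)) =
      Multiplicative.ofAdd (Pi.single l 1) := sumElimLift_ofInr _ _ l _
  have := (hS (ofInr l (Multiplicative.ofAdd 1))).1 (htop ▸ Subgroup.mem_top _)
  rw [hl] at this
  simpa using this

end RankInequalities

/-- Lemma 1 of the paper. Let `G = G_1 * … * G_n * F` and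
`H = H_1 * … * H_m * F'`, where each `G_i` is not infinite cyclic, each `H_j` is
nontrivial, and `F, F'` are free groups of finite ranks `p, q`.  If `φ : G → H` is a
surjective homomorphism mapping each `G_i` into a conjugate of some `H_j`, then
`n + p ≥ m + q` and `p ≥ q`. -/
theorem kurosh_rank_epimorphism {n m p q : ℕ}
    (Gf : Fin n → Type) (Hf : Fin m → Type)
    [∀ i, Group (Gf i)] [∀ j, Group (Hf j)]
    (hG : ∀ i, ¬ Nonempty (Gf i ≃* Multiplicative ℤ))
    (hH : ∀ j, Nontrivial (Hf j))
    (φ : CoprodI (Sum.elim Gf fun _ : Fin p => Multiplicative ℤ) →*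
        CoprodI (Sum.elim Hf fun _ : Fin q => Multiplicative ℤ))
    (hsurj : Function.Surjective φ)
    (hsym : ∀ i : Fin n, ∃ (j : Fin m) (h : CoprodI (Sum.elim Hf fun _ : Fin q => Multiplicative ℤ)),
      (factorSubgroup (M := Sum.elim Gf fun _ : Fin p => Multiplicative ℤ) (Sum.inl i)).map φ ≤
        conjSubgroup h (factorSubgroup (Sum.inl j))) :
    m + q ≤ n + p ∧ q ≤ p := by
  choose J g hJ using hsym
  have hgen : ∀ S : Subgroup (CoprodI (Sum.elim Hf fun _ : Fin q => Multiplicative ℤ)),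
      (∀ i, conjSubgroup (g i) (factorSubgroup (Sum.inl (J i))) ≤ S) →
      (∀ l : Fin p, φ (ofInr l (Multiplicative.ofAdd 1)) ∈ S) → S = ⊤ := by
    refine fun S hS hy => (Subgroup.eq_top_iff' S).2 fun h => ?_
    obtain ⟨x, rfl⟩ := hsurj h
    induction x using sumElim_induction with
    | one => exact (map_one φ).symm ▸ S.one_mem
    | inl i a => exact hS i (hJ i ⟨_, ⟨a, rfl⟩, rfl⟩)
    | inr l z =>
      have hz : z = Multiplicative.ofAdd 1 ^ z.toAdd := by
        rw [← ofAdd_zsmul]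
        simp
      rw [hz, map_zpow, map_zpow]
      exact S.zpow_mem (hy l) _
    | mul a b ha hb => exact (map_mul φ a b).symm ▸ S.mul_mem ha hb
  exact ⟨add_le_add_of_generates J g _ hgen, free_rank_le_of_generates J g _ hgen⟩
end

section
/- Let φ be an endomorphism of a finitely generated residually finite group G. Then the restriction φ_∞: φ^∞(G) → φ^∞(G) of φ to the stable image φ^∞(G) = ⋂_{n=1}^{∞} φ^n(G) is injective. -/
/-- A group is residually finite if every nontrivial element survives in some finite
quotient. -/
def ResiduallyFinite (G : Type*) [Group G] : Prop :=
  ∀ g : G, g ≠ 1 → ∃ (Γ : Type) (_ : Group Γ) (_ : Finite Γ) (π : G →* Γ), π g ≠ 1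

theorem iterHom_apply {G : Type*} [Group G] (φ : G →* G) (n : ℕ) (x : G) :
    iterHom φ n x = φ^[n] x := by
  induction n with
  | zero => rfl
  | succ n ih => rw [Function.iterate_succ_apply', ← ih]; rfl

theorem exists_iterate_eq_of_mem_stableImage {G : Type*} [Group G] {φ : G →* G} {g : G}
    (hg : g ∈ stableImage φ) (n : ℕ) : ∃ x, φ^[n] x = g := by
  obtain ⟨x, hx⟩ := Subgroup.mem_iInf.mp hg n
  exact ⟨φ x, by rw [← hx, iterHom_apply, Function.iterate_succ_apply]⟩

/-- There are only finitely many homomorphisms from a finitely generated group to a finite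
group. -/
theorem finite_monoidHom_of_fg {G Γ : Type*} [Group G] [Group Γ] [Finite Γ]
    (hfg : Group.FG G) : Finite (G →* Γ) := by
  obtain ⟨S, hS⟩ := Group.fg_def.mp hfg
  refine Finite.of_injective (fun (f : G →* Γ) (s : S) => f s) fun f₁ f₂ h => ?_
  exact MonoidHom.eq_of_eqOn_dense hS fun s hs => congrFun h ⟨s, hs⟩

/-- Lemma 3 of the paper. If `φ` is an endomorphism of a finitely
generated residually finite group `G`, then the restriction of `φ` to the stable image
`φ^∞(G) = ⋂ₙ φⁿ(G)` is injective. -/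
theorem injOn_stableImage_of_residuallyFinite {G : Type*} [Group G]
    (hfg : Group.FG G) (hrf : ResiduallyFinite G) (φ : G →* G) :
    Set.InjOn φ (stableImage φ : Set G) := by
  intro a ha b hb hab
  by_contra hne
  obtain ⟨Γ, _, _, π, hπ⟩ := hrf (a⁻¹ * b) (mt inv_mul_eq_one.mp hne)
  have : Finite (G →* Γ) := finite_monoidHom_of_fg hfg
  have hker : φ (a⁻¹ * b) = 1 := by rw [map_mul, map_inv, hab, inv_mul_cancel]
  obtain ⟨m, n, hlt, hmn⟩ : ∃ m n, m < n ∧ π.comp (iterHom φ m) = π.comp (iterHom φ n) := by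
    obtain ⟨m, n, hne, hmn⟩ :=
      Finite.exists_ne_map_eq_of_infinite fun n : ℕ => π.comp (iterHom φ n)
    rcases hne.lt_or_gt with h | h
    exacts [⟨m, n, h, hmn⟩, ⟨n, m, h, hmn.symm⟩]
  obtain ⟨k, rfl⟩ := Nat.exists_eq_add_of_lt hlt
  obtain ⟨x, hx⟩ :=
    exists_iterate_eq_of_mem_stableImage (mul_mem (inv_mem ha) hb : a⁻¹ * b ∈ stableImage φ) m
  apply hπ
  have h := DFunLike.congr_fun hmn x
  simp only [MonoidHom.comp_apply, iterHom_apply] at h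
  rw [show m + k + 1 = k + 1 + m by omega, Function.iterate_add_apply, hx,
    Function.iterate_succ_apply, hker, iterate_map_one, map_one] at h
  exact h
end
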